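/- arXiv:0809.0454 — 2 statements merged into one kernel-verified Lean document; each statement's English description precedes it below -/
import Mathlib

section
/- Let G be the graph obtained from the complete bipartite graph K_{4,4}, with parts {a1,a2,a3,a4} and {b1,b2,b3,b4}, by deleting the edge (a1,b1), and let w be a ℤ/2-edge-weighting of G. Suppose that every cycle of the induced complete bipartite subgraph on {a2,a3,a4} ∪ {b2,b3,b4} is even, that G has an odd cycle avoiding the vertex b1, and that G has an odd cycle avoiding the vertex a1. Then G contains two vertex-disjoint odd cycles. -/
open SimpleGraph

/-- The graph `K_{4,4}` minus the edge `(a1, b1)`, where `aᵢ = Sum.inl (i-1)` and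
`bⱼ = Sum.inr (j-1)`. -/
def K44me : SimpleGraph (Fin 4 ⊕ Fin 4) :=
  (completeBipartiteGraph (Fin 4) (Fin 4)).deleteEdges {s(Sum.inl 0, Sum.inr 0)}

/-- The ℤ/2-weight of a closed walk: the sum of the weights of its edges. -/
def cycWeight (w : Sym2 (Fin 4 ⊕ Fin 4) → ZMod 2) {v : Fin 4 ⊕ Fin 4}
    (c : K44me.Walk v v) : ZMod 2 :=
  (c.edges.map w).sum

/-- The weight of the (possibly degenerate) 4-cycle `aᵢ bⱼ aₖ bₗ`. -/
def squareWeight (w : Sym2 (Fin 4 ⊕ Fin 4) → ZMod 2) (i k j l : Fin 4) : ZMod 2 :=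
  w s(.inl i, .inr j) + w s(.inl k, .inr j) + w s(.inl k, .inr l) + w s(.inl i, .inr l)

theorem K44me_adj_inl_inr {i j : Fin 4} :
    K44me.Adj (.inl i) (.inr j) ↔ i ≠ 0 ∨ j ≠ 0 := by
  simp [K44me, imp_iff_not_or]

theorem exists_square_cycle (w : Sym2 (Fin 4 ⊕ Fin 4) → ZMod 2) {i k j l : Fin 4}
    (hik : i ≠ k) (hjl : j ≠ l) (h : (i ≠ 0 ∧ k ≠ 0) ∨ (j ≠ 0 ∧ l ≠ 0)) :
    ∃ c : K44me.Walk (.inl i) (.inl i), c.IsCycle ∧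
      c.support = [.inl i, .inr j, .inl k, .inr l, .inl i] ∧
      cycWeight w c = squareWeight w i k j l := by
  have hij : K44me.Adj (.inl i) (.inr j) := K44me_adj_inl_inr.2 (by tauto)
  have hjk : K44me.Adj (.inr j) (.inl k) := (K44me_adj_inl_inr.2 (by tauto)).symm
  have hkl : K44me.Adj (.inl k) (.inr l) := K44me_adj_inl_inr.2 (by tauto)
  have hli : K44me.Adj (.inr l) (.inl i) := (K44me_adj_inl_inr.2 (by tauto)).symm
  refine ⟨.cons hij (.cons hjk (.cons hkl (.cons hli .nil))), ?_, rfl, ?_⟩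
  · simp [Walk.cons_isCycle_iff, hik, hjl, hik.symm]
  · simp [cycWeight, squareWeight, add_assoc, Sym2.eq_swap (a := Sum.inr j),
      Sym2.eq_swap (a := Sum.inr l)]

/-- If the weight is the coboundary of `φ` away from `z`, then the weight of a walk avoiding `z`
depends only on its endpoints. -/
theorem sum_edges_eq_of_potential {V : Type*} {G : SimpleGraph V} {w : Sym2 V → ZMod 2} {z : V}
    {φ : V → ZMod 2} (h : ∀ x y, G.Adj x y → x ≠ z → y ≠ z → w s(x, y) = φ x + φ y)
    {u v : V} (p : G.Walk u v) (hz : z ∉ p.support) :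
    (p.edges.map w).sum = φ u + φ v := by
  induction p with
  | nil => simp [CharTwo.add_self_eq_zero]
  | @cons a b c hab p ih =>
    rw [Walk.support_cons, List.mem_cons, not_or] at hz
    have hb : b ≠ z := fun hb => hz.2 (hb ▸ p.start_mem_support)
    rw [Walk.edges_cons, List.map_cons, List.sum_cons, ih hz.2, h a b hab (Ne.symm hz.1) hb]
    linear_combination CharTwo.add_self_eq_zero (φ b)

theorem exists_squareWeight_eq_one {w : Sym2 (Fin 4 ⊕ Fin 4) → ZMod 2} {z v : Fin 4 ⊕ Fin 4}
    (c : K44me.Walk v v) (hz : z ∉ c.support) (hc : cycWeight w c = 1) (r s : Fin 4) :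
    ∃ i j, .inl i ≠ z ∧ .inr j ≠ z ∧ squareWeight w i r j s = 1 := by
  by_contra! hne
  have hsq : ∀ i j, .inl i ≠ z → .inr j ≠ z → w s(.inl i, .inr j) =
      w s(.inl i, .inr s) + (w s(.inl r, .inr j) + w s(.inl r, .inr s)) := by
    intro i j hi hj
    have h := hne i j hi hj
    unfold squareWeight at h
    generalize w s(.inl i, .inr j) = p at *
    generalize w s(.inl i, .inr s) = q at *
    generalize w s(.inl r, .inr j) = t at *
    generalize w s(.inl r, .inr s) = x at *
    clear hne hc
    revert p q t x
    decide
  have hw := sum_edges_eq_of_potential (G := K44me) (w := w) (z := z)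
    (φ := Sum.elim (fun i => w s(.inl i, .inr s))
      fun j => w s(.inl r, .inr j) + w s(.inl r, .inr s)) (by
    rintro (i | i) (j | j) hadj hi hj
    · simp [K44me] at hadj
    · exact hsq i j hi hj
    · rw [Sym2.eq_swap, add_comm]
      exact hsq j i hj hi
    · simp [K44me] at hadj) c hz
  rw [CharTwo.add_self_eq_zero] at hw
  exact one_ne_zero (hc.symm.trans hw)

/-- let `G = K_{4,4} - (a1,b1)` with a ℤ/2-edge-weighting `w`.  Suppose every
cycle of the induced complete bipartite subgraph on `{a2,a3,a4} ∪ {b2,b3,b4}` (i.e. every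
cycle of `G` avoiding both `a1` and `b1`) is even, `G` has an odd cycle avoiding `b1`, and
`G` has an odd cycle avoiding `a1`.  Then `G` has two vertex-disjoint odd cycles. -/
theorem stmt5 (w : Sym2 (Fin 4 ⊕ Fin 4) → ZMod 2)
    (hA : ∀ (v : Fin 4 ⊕ Fin 4) (c : K44me.Walk v v), c.IsCycle →
      Sum.inl 0 ∉ c.support → Sum.inr 0 ∉ c.support → cycWeight w c = 0)
    (hb : ∃ (v : Fin 4 ⊕ Fin 4) (c : K44me.Walk v v),
      c.IsCycle ∧ Sum.inr 0 ∉ c.support ∧ cycWeight w c = 1)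
    (ha : ∃ (v : Fin 4 ⊕ Fin 4) (c : K44me.Walk v v),
      c.IsCycle ∧ Sum.inl 0 ∉ c.support ∧ cycWeight w c = 1) :
    ∃ (u v : Fin 4 ⊕ Fin 4) (c1 : K44me.Walk u u) (c2 : K44me.Walk v v),
      c1.IsCycle ∧ c2.IsCycle ∧ cycWeight w c1 = 1 ∧ cycWeight w c2 = 1 ∧
      ∀ x, ¬(x ∈ c1.support ∧ x ∈ c2.support) := by
  have hA' : ∀ i k j l : Fin 4, i ≠ 0 → k ≠ 0 → j ≠ 0 → l ≠ 0 →
      squareWeight w i k j l = 0 := by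
    intro i k j l hi hk hj hl
    by_cases hik : i = k
    · subst hik
      unfold squareWeight
      rw [CharTwo.add_self_eq_zero, zero_add, CharTwo.add_self_eq_zero]
    by_cases hjl : j = l
    · subst hjl
      unfold squareWeight
      rw [add_assoc, add_comm (w s(.inl k, .inr j)) (w s(.inl i, .inr j)),
        CharTwo.add_self_eq_zero]
    obtain ⟨c, hc, hs, hw⟩ := exists_square_cycle w hik hjl (.inl ⟨hi, hk⟩)
    rw [← hw]
    exact hA _ c hc (by simp [hs, hi.symm, hk.symm]) (by simp [hs, hj.symm, hl.symm])
  obtain ⟨_, c, -, hz, hc⟩ := hb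
  obtain ⟨i, j, -, hj, hij⟩ := exists_squareWeight_eq_one c hz hc 1 1
  obtain ⟨_, d, -, hz', hd⟩ := ha
  obtain ⟨k, l, hk, -, hkl⟩ := exists_squareWeight_eq_one d hz' hd 1 1
  rw [Sum.inr_injective.ne_iff] at hj
  rw [Sum.inl_injective.ne_iff] at hk
  obtain rfl : i = 0 := by
    by_contra hi
    simp [hA' i 1 j 1 hi one_ne_zero hj one_ne_zero] at hij
  obtain rfl : l = 0 := by
    by_contra hl
    simp [hA' k 1 l 1 hk one_ne_zero hl one_ne_zero] at hkl
  have hj1 : j ≠ 1 := by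
    rintro rfl
    unfold squareWeight at hij
    generalize w s(.inl 0, .inr 1) = p at hij
    generalize w s(.inl 1, .inr 1) = q at hij
    revert p q
    decide
  have hk1 : k ≠ 1 := by
    rintro rfl
    unfold squareWeight at hkl
    generalize w s(.inl 1, .inr 0) = p at hkl
    generalize w s(.inl 1, .inr 1) = q at hkl
    revert p q
    decide
  have hfree : ∀ x : Fin 4, ∃ m, m ≠ 0 ∧ m ≠ 1 ∧ m ≠ x := by decide
  obtain ⟨m, hm0, hm1, hmk⟩ := hfree k
  obtain ⟨n, hn0, hn1, hnj⟩ := hfree j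
  obtain ⟨c₁, hc₁, hs₁, hw₁⟩ := exists_square_cycle w hm0.symm hj1 (.inr ⟨hj, one_ne_zero⟩)
  obtain ⟨c₂, hc₂, hs₂, hw₂⟩ := exists_square_cycle w hk1 hn0.symm (.inl ⟨hk, one_ne_zero⟩)
  refine ⟨_, _, c₁, c₂, hc₁, hc₂, ?_, ?_, ?_⟩
  · have h := hA' 1 m j 1 one_ne_zero hm0 hj one_ne_zero
    rw [hw₁]
    unfold squareWeight at *
    linear_combination hij + h - CharTwo.add_self_eq_zero (w s(.inl 1, .inr j)) -
      CharTwo.add_self_eq_zero (w s(.inl 1, .inr 1))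
  · have h := hA' k 1 1 n hk one_ne_zero one_ne_zero hn0
    rw [hw₂]
    unfold squareWeight at *
    linear_combination hkl + h - CharTwo.add_self_eq_zero (w s(.inl k, .inr 1)) -
      CharTwo.add_self_eq_zero (w s(.inl 1, .inr 1))
  · rintro (x | x) ⟨h₁, h₂⟩
    · simp only [hs₁, hs₂, List.mem_cons, List.not_mem_nil, Sum.inl.injEq, reduceCtorEq] at h₁ h₂
      grind
    · simp only [hs₁, hs₂, List.mem_cons, List.not_mem_nil, Sum.inr.injEq, reduceCtorEq] at h₁ h₂
      grind
end

section
/- Let G be the graph obtained from the complete bipartite graph K_{4,4}, with parts {a1,a2,a3,a4} and {b1,b2,b3,b4}, by deleting the edge (a1,b1), and let w be a ℤ/2-edge-weighting of G. Suppose that: (i) the induced complete bipartite subgraph on {a2,a3,a4} ∪ {b2,b3,b4} has a 4-pattern with including edge (a4,b4), i.e., a 4-cycle of this subgraph is odd if and only if it contains the edge (a4,b4); (ii) every cycle of the induced complete bipartite subgraph on {a1,a2,a3} ∪ {b2,b3,b4} is even; and (iii) every cycle of the induced complete bipartite subgraph on {a2,a3,a4} ∪ {b1,b2,b3} is even. Then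 every odd cycle of G passes through the vertex a4. -/
open SimpleGraph

theorem K44me_adj_inl_inr_s7 {i j : Fin 4} :
    K44me.Adj (Sum.inl i) (Sum.inr j) ↔ ¬(i = 0 ∧ j = 0) := by
  simp [K44me, completeBipartiteGraph]

/-- Four vertices of `K44me`, alternating between the parts, span a 4-cycle. -/
theorem exists_isCycle_of_adj (w : Sym2 (Fin 4 ⊕ Fin 4) → ZMod 2) {i i' j j' : Fin 4}
    (hi : i ≠ i') (hj : j ≠ j')
    (h₁ : K44me.Adj (Sum.inl i) (Sum.inr j)) (h₂ : K44me.Adj (Sum.inl i') (Sum.inr j))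
    (h₃ : K44me.Adj (Sum.inl i') (Sum.inr j')) (h₄ : K44me.Adj (Sum.inl i) (Sum.inr j')) :
    ∃ c : K44me.Walk (Sum.inl i) (Sum.inl i), c.IsCycle ∧
      c.support = [Sum.inl i, Sum.inr j, Sum.inl i', Sum.inr j', Sum.inl i] ∧
      cycWeight w c = w s(Sum.inl i, Sum.inr j) + w s(Sum.inl i', Sum.inr j) +
        w s(Sum.inl i', Sum.inr j') + w s(Sum.inl i, Sum.inr j') := by
  refine ⟨.cons h₁ (.cons h₂.symm (.cons h₃ (.cons h₄.symm .nil))), ?_, rfl, ?_⟩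
  · rw [Walk.cons_isCycle_iff]
    simp [hi, hi.symm, hj]
  · simp [cycWeight, Sym2.eq_swap (a := Sum.inr _), add_assoc]

/-- If the weighting is the coboundary of `f` along the edges of a walk, then the total weight of
the walk is the sum of the values of `f` at its ends. -/
theorem SimpleGraph.Walk.sum_map_edges_eq_of_coboundary {V : Type*} {G : SimpleGraph V}
    (w : Sym2 V → ZMod 2) (f : V → ZMod 2) {u v : V} (p : G.Walk u v)
    (h : ∀ x ∈ p.support, ∀ y ∈ p.support, G.Adj x y → w s(x, y) = f x + f y) :
    (p.edges.map w).sum = f u + f v := by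
  induction p with
  | nil => simp [CharTwo.add_self_eq_zero]
  | @cons u x v hux p ih =>
    have hw : w s(u, x) = f u + f x := h _ (by simp) _ (by simp) hux
    have hp := ih fun y hy z hz => h y (by simp [hy]) z (by simp [hz])
    rw [Walk.edges_cons, List.map_cons, List.sum_cons, hw, hp]
    linear_combination CharTwo.add_self_eq_zero (f x)

/-- let `G = K_{4,4} - (a1,b1)` with a ℤ/2-edge-weighting `w`.  Suppose:
(i) the induced subgraph on `{a2,a3,a4} ∪ {b2,b3,b4}` has a 4-pattern with including edge
`(a4,b4)`: a 4-cycle of `G` avoiding `a1` and `b1` is odd iff it contains `(a4,b4)`;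
(ii) every cycle of `G` avoiding `a4` and `b1` (i.e. of the induced subgraph on
`{a1,a2,a3} ∪ {b2,b3,b4}`) is even; and
(iii) every cycle of `G` avoiding `a1` and `b4` (i.e. of the induced subgraph on
`{a2,a3,a4} ∪ {b1,b2,b3}`) is even.
Then every odd cycle of `G` passes through the vertex `a4`. -/
theorem stmt7 (w : Sym2 (Fin 4 ⊕ Fin 4) → ZMod 2)
    (hA : ∀ (v : Fin 4 ⊕ Fin 4) (c : K44me.Walk v v), c.IsCycle → c.length = 4 →
      Sum.inl 0 ∉ c.support → Sum.inr 0 ∉ c.support →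
      (cycWeight w c = 1 ↔ s(Sum.inl 3, Sum.inr 3) ∈ c.edges))
    (hB : ∀ (v : Fin 4 ⊕ Fin 4) (c : K44me.Walk v v), c.IsCycle →
      Sum.inl 3 ∉ c.support → Sum.inr 0 ∉ c.support → cycWeight w c = 0)
    (hC : ∀ (v : Fin 4 ⊕ Fin 4) (c : K44me.Walk v v), c.IsCycle →
      Sum.inl 0 ∉ c.support → Sum.inr 3 ∉ c.support → cycWeight w c = 0) :
    ∀ (v : Fin 4 ⊕ Fin 4) (c : K44me.Walk v v), c.IsCycle → cycWeight w c = 1 →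
      Sum.inl 3 ∈ c.support := by
  intro v c _ hodd
  by_contra hv
  have four {i j : Fin 4} (hi : i ≠ 1) (hi' : i ≠ 3) (hj : j ≠ 1) (hij : ¬(i = 0 ∧ j = 0)) :
      w s(Sum.inl i, Sum.inr j) + w s(Sum.inl 1, Sum.inr j) +
        w s(Sum.inl 1, Sum.inr 1) + w s(Sum.inl i, Sum.inr 1) = 0 := by
    obtain ⟨c, hc, hs, hw⟩ := exists_isCycle_of_adj w hi hj (K44me_adj_inl_inr_s7.2 hij)
      (K44me_adj_inl_inr_s7.2 (by simp)) (K44me_adj_inl_inr_s7.2 (by simp))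
      (K44me_adj_inl_inr_s7.2 (by simp))
    rw [← hw]
    by_cases h0 : j = 0
    · subst h0
      have hi0 : 0 ≠ i := fun h => hij ⟨h.symm, rfl⟩
      exact hC _ c hc (by simp [hs, hi0]) (by simp [hs])
    · exact hB _ c hc (by simp [hs, hi'.symm]) (by simp [hs, Ne.symm h0])
  let f : Fin 4 ⊕ Fin 4 → ZMod 2 := Sum.elim (fun i => w s(Sum.inl i, Sum.inr 1))
    (fun j => w s(Sum.inl 1, Sum.inr j) + w s(Sum.inl 1, Sum.inr 1))
  have key {i j : Fin 4} (hi : i ≠ 3) (hij : K44me.Adj (Sum.inl i) (Sum.inr j)) :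
      w s(Sum.inl i, Sum.inr j) = f (Sum.inl i) + f (Sum.inr j) := by
    rw [K44me_adj_inl_inr_s7] at hij
    simp only [f, Sum.elim_inl, Sum.elim_inr]
    rcases eq_or_ne i 1 with rfl | hi1
    · linear_combination -CharTwo.add_self_eq_zero (w s(Sum.inl 1, Sum.inr 1))
    rcases eq_or_ne j 1 with rfl | hj1
    · linear_combination -CharTwo.add_self_eq_zero (w s(Sum.inl 1, Sum.inr 1))
    rw [← CharTwo.add_eq_zero]
    linear_combination four hi1 hi hj1 hij
  have hsum : cycWeight w c = f v + f v := by
    refine c.sum_map_edges_eq_of_coboundary w f ?_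
    rintro (i | j) hx (i' | j') hy hxy
    · simp [K44me] at hxy
    · exact key (by rintro rfl; exact hv hx) hxy
    · rw [Sym2.eq_swap, add_comm]
      exact key (by rintro rfl; exact hv hy) hxy.symm
    · simp [K44me] at hxy
  rw [hodd, CharTwo.add_self_eq_zero] at hsum
  exact one_ne_zero hsum
end
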